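/- (Asymptotic approximation of Implicit-CKs.) Fix σ_a ∈ ℝ with 0 < σ_a² < 1 and c ∈ (0,∞). For each n, let d = d(n) with d(n)/n → c as n → ∞, and let x₁,…,xₙ be i.i.d. random vectors uniformly distributed on the unit sphere S^{d−1} ⊂ ℝ^d, with X = [x₁,…,xₙ] ∈ ℝ^{d×n}. Let G* ∈ ℝ^{n×n} be the Implicit-CK matrix with entries G*_{ij} = g(xᵢᵀxⱼ), where g(t) is the unique fixed point in [−1,1] of x = σ_a²·f(x) + (1−σ_a²)·t and f(x) = (√(1−x²) + (π − arccos x)·x)/π. Define Ḡ = α·𝟙𝟙ᵀ + β·XᵀX + μ·Iₙ with α = g(0) + g″(0)/(2d), β = g′(0), μ = g(1) − g(0) − g′(0). Then the spectral (operator) norm ‖G* − Ḡ‖₂ converges to 0 in probability as n → ∞. -/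

import Mathlib

open MeasureTheory ProbabilityTheory Real Filter
open scoped RealInnerProductSpace

/-- The dual kernel of the normalized ReLU activation `φ(x) = √2·max(x,0)`. -/
noncomputable def fDual (x : ℝ) : ℝ :=
  (Real.sqrt (1 - x ^ 2) + (Real.pi - Real.arccos x) * x) / Real.pi

/-- The uniform probability distribution on the unit sphere `S^{d-1} ⊂ ℝ^d`:
the normalization of the cone (surface) measure induced by the Lebesgue measure. -/
noncomputable def uniformSphere (d : ℕ) :
    Measure (Metric.sphere (0 : EuclideanSpace ℝ (Fin d)) 1) :=
  ((volume : Measure (EuclideanSpace ℝ (Fin d))).toSphere Set.univ)⁻¹ •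
    (volume : Measure (EuclideanSpace ℝ (Fin d))).toSphere

/-- The spectral (`ℓ₂ → ℓ₂` operator) norm of a square real matrix. -/
noncomputable def opNorm {n : ℕ} (M : Matrix (Fin n) (Fin n) ℝ) : ℝ :=
  ‖LinearMap.toContinuousLinearMap (Matrix.toEuclideanLin M)‖

lemma hasDerivAt_fDual {x : ℝ} (h1 : -1 < x) (h2 : x < 1) :
    HasDerivAt fDual ((Real.pi - Real.arccos x) / Real.pi) x := by
  have hpos : 0 < 1 - x ^ 2 := by nlinarith
  have hs : HasDerivAt (fun x : ℝ => Real.sqrt (1 - x ^ 2)) (-(2 * x) / (2 * Real.sqrt (1 - x ^ 2))) x := by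
    have : HasDerivAt (fun x : ℝ => 1 - x ^ 2) (-(2 * x)) x := by
      simpa using (hasDerivAt_pow 2 x).const_sub 1
    exact this.sqrt hpos.ne'
  have ha := Real.hasDerivAt_arccos (x := x) h1.ne' h2.ne
  have := (hs.add ((ha.const_sub Real.pi).mul (hasDerivAt_id x))).div_const Real.pi
  refine HasDerivAt.congr_deriv this ?_
  have hsq : Real.sqrt (1 - x ^ 2) ≠ 0 := (Real.sqrt_pos.2 hpos).ne'
  have := Real.pi_ne_zero
  simp only [id]
  field_simp
  ring

lemma contDiffAt_fDual {x : ℝ} (h1 : -1 < x) (h2 : x < 1) : ContDiffAt ℝ 2 fDual x := by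
  have hpos : 0 < 1 - x ^ 2 := by nlinarith
  unfold fDual
  refine ContDiffAt.div_const (ContDiffAt.add ?_ ?_) _
  · exact ContDiffAt.sqrt (by fun_prop) hpos.ne'
  · exact (contDiffAt_const.sub (Real.contDiffAt_arccos h1.ne' h2.ne)).mul contDiffAt_id

lemma continuous_fDual : Continuous fDual := by
  unfold fDual
  have := Real.continuous_arccos
  fun_prop

lemma g_contDiffAt (s : ℝ) (hs0 : 0 < s) (hs1 : s < 1) (g : ℝ → ℝ)
    (hg : ∀ t ∈ Set.Icc (-1 : ℝ) 1,
      g t ∈ Set.Icc (-1 : ℝ) 1 ∧ g t = s * fDual (g t) + (1 - s) * t) :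
    ContDiffAt ℝ 2 g 0 := by
  set h : ℝ → ℝ := fun x => (x - s * fDual x) / (1 - s) with hh
  have hs1' : 0 < 1 - s := by linarith
  have hcont : Continuous h := by
    have := continuous_fDual
    fun_prop
  have hder : ∀ x, -1 < x → x < 1 → HasDerivAt h ((1 - s * ((Real.pi - Real.arccos x) / Real.pi)) / (1 - s)) x := by
    intro x h1 h2
    exact ((hasDerivAt_id x).sub ((hasDerivAt_fDual h1 h2).const_mul s)).div_const _
  have hderpos : ∀ x, 0 < (1 - s * ((Real.pi - Real.arccos x) / Real.pi)) / (1 - s) := by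
    intro x
    apply div_pos _ hs1'
    have h3 : (Real.pi - Real.arccos x) / Real.pi ≤ 1 := by
      rw [div_le_one Real.pi_pos]; linarith [Real.arccos_nonneg x]
    nlinarith
  have hmono : StrictMonoOn h (Set.Icc (-1) 1) := by
    apply strictMonoOn_of_deriv_pos (convex_Icc _ _) hcont.continuousOn
    intro x hx
    rw [interior_Icc] at hx
    rw [(hder x hx.1 hx.2).deriv]
    exact hderpos x
  have hhg : ∀ t ∈ Set.Icc (-1 : ℝ) 1, h (g t) = t := by
    intro t ht
    have := (hg t ht).2
    simp only [hh]
    rw [div_eq_iff hs1'.ne']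
    linarith
  have h0mem : (0 : ℝ) ∈ Set.Icc (-1 : ℝ) 1 := by constructor <;> norm_num
  have hg0 := (hg 0 h0mem).1
  have hhg0 := hhg 0 h0mem
  have hpi := Real.pi_pos
  have f1 : fDual 1 = 1 := by simp [fDual]
  have f2 : fDual (-1) = 0 := by simp [fDual]
  have hg0l : -1 < g 0 := by
    rcases hg0.1.lt_or_eq with h | h
    · exact h
    · rw [← h] at hhg0
      simp only [hh, f2, div_eq_zero_iff] at hhg0
      rcases hhg0 with h | h <;> linarith
  have hg0r : g 0 < 1 := by
    rcases hg0.2.lt_or_eq with h | h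
    · exact h
    · rw [h] at hhg0
      simp only [hh, f1, div_eq_zero_iff] at hhg0
      rcases hhg0 with h | h <;> linarith
  have hcd : ContDiffAt ℝ 2 h (g 0) :=
    (contDiffAt_id.sub (contDiffAt_const.mul (contDiffAt_fDual hg0l hg0r))).div_const _
  have hd := hder _ hg0l hg0r
  have hne := (hderpos (g 0)).ne'
  set D := (1 - s * ((Real.pi - Real.arccos (g 0)) / Real.pi)) / (1 - s)
  have hfd : HasFDerivAt h ((ContinuousLinearEquiv.unitsEquivAut ℝ (Units.mk0 D hne) : ℝ ≃L[ℝ] ℝ) : ℝ →L[ℝ] ℝ) (g 0) := by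
    have he : ((ContinuousLinearEquiv.unitsEquivAut ℝ (Units.mk0 D hne) : ℝ ≃L[ℝ] ℝ) : ℝ →L[ℝ] ℝ)
        = ContinuousLinearMap.toSpanSingleton ℝ D := by
      ext; simp
    rw [he]
    exact hd.hasFDerivAt
  have hinv := hcd.to_localInverse hfd (by norm_num)
  have hval := hcd.localInverse_apply_image hfd (by norm_num)
  have hstrict := hcd.hasStrictFDerivAt' hfd (by norm_num)
  have hri := hstrict.eventually_right_inverse
  rw [hhg0] at hinv hval hri
  refine hinv.congr_of_eventuallyEq ?_
  have hc := hinv.continuousAt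
  have hmem : ∀ᶠ t in nhds (0:ℝ), hcd.localInverse hfd (by norm_num) t ∈ Set.Icc (-1:ℝ) 1 := by
    apply hc.eventually
    rw [hval]
    exact Icc_mem_nhds hg0l hg0r
  have hmem2 : ∀ᶠ t in nhds (0:ℝ), t ∈ Set.Icc (-1:ℝ) 1 := Icc_mem_nhds (by norm_num) (by norm_num)
  filter_upwards [hri, hmem, hmem2] with t h1 h2 h3
  exact hmono.injOn (hg t h3).1 h2 ((hhg t h3).trans h1.symm)

lemma peano2 (g : ℝ → ℝ) (hg : ContDiffAt ℝ 2 g 0) (ε : ℝ) (hε : 0 < ε) :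
    ∃ δ > 0, ∀ t, |t| < δ →
      |g t - g 0 - deriv g 0 * t - deriv (deriv g) 0 / 2 * t ^ 2| ≤ ε * t ^ 2 := by
  have h1 : ∀ᶠ t in nhds (0:ℝ), DifferentiableAt ℝ g t := by
    have := hg.eventually (by simp)
    filter_upwards [this] with t ht
    exact ht.differentiableAt (by norm_num)
  have h2 : HasDerivAt (deriv g) (deriv (deriv g) 0) 0 := by
    have : ContDiffAt ℝ 1 (deriv g) 0 := hg.derivWithin (by norm_num)
    exact (this.differentiableAt (by norm_num)).hasDerivAt
  rw [hasDerivAt_iff_isLittleO] at h2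
  have h3 := h2.def hε
  obtain ⟨δ, hδ, H⟩ := Metric.eventually_nhds_iff_ball.1 (h1.and h3)
  refine ⟨δ, hδ, fun t ht => ?_⟩
  set φ : ℝ → ℝ := fun t => g t - g 0 - deriv g 0 * t - deriv (deriv g) 0 / 2 * t ^ 2 with hφ
  have hb : ∀ x, |x| ≤ |t| → x ∈ Metric.ball (0:ℝ) δ := by
    intro x hx; simp; exact hx.trans_lt ht
  have hd : ∀ x ∈ Set.uIcc 0 t, HasDerivWithinAt φ (deriv g x - deriv g 0 - x * deriv (deriv g) 0) (Set.uIcc 0 t) x := by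
    intro x hx
    have hx' : |x| ≤ |t| := by simpa using Set.abs_sub_left_of_mem_uIcc hx
    have hdg := (H x (hb x hx')).1.hasDerivAt
    have := ((hdg.sub_const (g 0)).sub ((hasDerivAt_id x).const_mul (deriv g 0))).sub ((hasDerivAt_pow 2 x).const_mul (deriv (deriv g) 0 / 2))
    refine (HasDerivAt.congr_deriv this ?_).hasDerivWithinAt
    simp; ring
  have := Convex.norm_image_sub_le_of_norm_hasDerivWithin_le (C := ε * |t|) hd ?_ (convex_uIcc _ _) Set.left_mem_uIcc Set.right_mem_uIcc
  · have h0 : φ 0 = 0 := by simp [hφ]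
    rw [h0] at this
    simp only [sub_zero, Real.norm_eq_abs] at this
    calc _ ≤ _ := this
      _ = ε * t ^ 2 := by rw [mul_assoc, abs_mul_abs_self]; ring
  · intro x hx
    have hx' : |x| ≤ |t| := by simpa using Set.abs_sub_left_of_mem_uIcc hx
    have := (H x (hb x hx')).2
    simp only [sub_zero, smul_eq_mul, Real.norm_eq_abs] at this
    exact this.trans (by gcongr)

lemma int_comb4 {α : Type*} [MeasurableSpace α] (μ : Measure α) (f1 f2 f3 f4 : α → ℝ)
    (h1 : Integrable f1 μ) (h2 : Integrable f2 μ) (h3 : Integrable f3 μ) (h4 : Integrable f4 μ)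
    (c1 c2 c3 c4 : ℝ) :
    ∫ y, (c1 * f1 y + c2 * f2 y + c3 * f3 y + c4 * f4 y) ∂μ
      = c1 * ∫ y, f1 y ∂μ + c2 * ∫ y, f2 y ∂μ + c3 * ∫ y, f3 y ∂μ + c4 * ∫ y, f4 y ∂μ := by
  rw [integral_add (by fun_prop) (by fun_prop), integral_add (by fun_prop) (by fun_prop),
    integral_add (by fun_prop) (by fun_prop)]
  simp only [integral_const_mul]

lemma int_comb6 {α : Type*} [MeasurableSpace α] (μ : Measure α) (f1 f2 f3 f4 f5 f6 : α → ℝ)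
    (h1 : Integrable f1 μ) (h2 : Integrable f2 μ) (h3 : Integrable f3 μ) (h4 : Integrable f4 μ)
    (h5 : Integrable f5 μ) (h6 : Integrable f6 μ) (c1 c2 c3 c4 c5 c6 : ℝ) :
    ∫ y, (c1 * f1 y + c2 * f2 y + c3 * f3 y + c4 * f4 y + c5 * f5 y + c6 * f6 y) ∂μ
      = c1 * ∫ y, f1 y ∂μ + c2 * ∫ y, f2 y ∂μ + c3 * ∫ y, f3 y ∂μ + c4 * ∫ y, f4 y ∂μ
        + c5 * ∫ y, f5 y ∂μ + c6 * ∫ y, f6 y ∂μ := by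
  rw [integral_add (by fun_prop) (by fun_prop), integral_add (by fun_prop) (by fun_prop),
    int_comb4 μ f1 f2 f3 f4 h1 h2 h3 h4]
  simp only [integral_const_mul]

/-- Short name for the sphere. -/
abbrev Sph (d : ℕ) : Type := Metric.sphere (0 : EuclideanSpace ℝ (Fin d)) 1

lemma isProb_uniformSphere (d : ℕ) (hd : 1 ≤ d) : IsProbabilityMeasure (uniformSphere d) := by
  constructor
  have : Nonempty (Fin d) := ⟨⟨0, hd⟩⟩
  unfold uniformSphere
  rw [Measure.smul_apply, smul_eq_mul]
  apply ENNReal.inv_mul_cancel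
  · rw [Ne, Measure.measure_univ_eq_zero]
    exact Measure.toSphere_ne_zero _
  · exact measure_ne_top _ _

/-- Action of an isometry on the sphere. -/
noncomputable def sphMap {d : ℕ} (T : EuclideanSpace ℝ (Fin d) ≃ₗᵢ[ℝ] EuclideanSpace ℝ (Fin d)) (y : Sph d) : Sph d :=
  ⟨T y, by simp⟩

lemma continuous_sphMap {d : ℕ} (T : EuclideanSpace ℝ (Fin d) ≃ₗᵢ[ℝ] EuclideanSpace ℝ (Fin d)) :
    Continuous (sphMap T) := by
  unfold sphMap
  exact Continuous.subtype_mk (T.continuous.comp continuous_subtype_val) _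

open scoped Pointwise in
lemma mp_sphMap {d : ℕ} (T : EuclideanSpace ℝ (Fin d) ≃ₗᵢ[ℝ] EuclideanSpace ℝ (Fin d)) :
    MeasurePreserving (sphMap T) (uniformSphere d) (uniformSphere d) := by
  have hm : Measurable (sphMap T) := (continuous_sphMap T).measurable
  refine ⟨hm, ?_⟩
  ext s hs
  rw [Measure.map_apply hm hs]
  unfold uniformSphere
  rw [Measure.smul_apply, Measure.smul_apply, Measure.toSphere_apply' _ hs,
    Measure.toSphere_apply' _ (hm hs)]
  congr 2
  have : (Set.Ioo (0:ℝ) 1 • ((fun x : Sph d => (x : EuclideanSpace ℝ (Fin d))) '' (sphMap T ⁻¹' s)))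
      = T ⁻¹' (Set.Ioo (0:ℝ) 1 • ((fun x : Sph d => (x : EuclideanSpace ℝ (Fin d))) '' s)) := by
    ext x
    simp only [Set.mem_smul, Set.mem_image, Set.mem_preimage]
    constructor
    · rintro ⟨r, hr, _, ⟨y, hy, rfl⟩, rfl⟩
      exact ⟨r, hr, _, ⟨_, hy, rfl⟩, by simp [sphMap]⟩
    · rintro ⟨r, hr, _, ⟨y, hy, rfl⟩, h⟩
      refine ⟨r, hr, _, ⟨sphMap T.symm y, ?_, rfl⟩, ?_⟩
      · convert hy
        simp [sphMap]
      · apply T.injective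
        rw [← h]
        simp [sphMap]
  rw [this]
  exact (T.measurePreserving).measure_preimage_emb T.toHomeomorph.measurableEmbedding _

lemma integrable_sph {d : ℕ} (hd : 1 ≤ d) (F : Sph d → ℝ) (hF : Continuous F) :
    Integrable F (uniformSphere d) := by
  have := isProb_uniformSphere d hd
  exact hF.integrable_of_hasCompactSupport (HasCompactSupport.of_compactSpace F)

lemma moment_eq {d : ℕ} (k : ℕ) (u v : EuclideanSpace ℝ (Fin d)) (h : ‖u‖ = ‖v‖) :
    ∫ y, ⟪u, (y : EuclideanSpace ℝ (Fin d))⟫ ^ k ∂(uniformSphere d) =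
    ∫ y, ⟪v, (y : EuclideanSpace ℝ (Fin d))⟫ ^ k ∂(uniformSphere d) := by
  set T := (ℝ ∙ (v - u))ᗮ.reflection with hT
  have hTv : T v = u := Submodule.reflection_sub h.symm
  have hmp := mp_sphMap T
  have hc : Continuous (fun y : Sph d => ⟪u, (y : EuclideanSpace ℝ (Fin d))⟫ ^ k) := by fun_prop
  have h1 := integral_map (μ := uniformSphere d) hmp.measurable.aemeasurable (f := fun y : Sph d => ⟪u, (y : EuclideanSpace ℝ (Fin d))⟫ ^ k) hc.aestronglyMeasurable
  rw [hmp.map_eq] at h1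
  rw [h1]
  congr 1
  ext y
  congr 1
  simp only [sphMap]
  rw [← hTv, T.inner_map_map]

/-- moments of a coordinate -/
noncomputable def mom (d : ℕ) (k : ℕ) (hd : 1 ≤ d) : ℝ :=
  ∫ y, ⟪EuclideanSpace.single (⟨0, hd⟩ : Fin d) (1:ℝ), ((y : Sph d) : EuclideanSpace ℝ (Fin d))⟫ ^ k ∂(uniformSphere d)

lemma moment_eq_mom {d : ℕ} (hd : 1 ≤ d) (k : ℕ) (u : EuclideanSpace ℝ (Fin d)) :
    ∫ y, ⟪u, ((y : Sph d) : EuclideanSpace ℝ (Fin d))⟫ ^ k ∂(uniformSphere d) = ‖u‖ ^ k * mom d k hd := by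
  rw [moment_eq k u (‖u‖ • EuclideanSpace.single (⟨0, hd⟩ : Fin d) (1:ℝ)) (by simp [norm_smul])]
  simp only [inner_smul_left, mul_pow]
  rw [integral_const_mul]
  simp [mom]

lemma sum_sq_sph {d : ℕ} (y : Sph d) :
    ∑ j, ⟪EuclideanSpace.single j (1:ℝ), (y : EuclideanSpace ℝ (Fin d))⟫ ^ 2 = 1 := by
  have h : ‖(y : EuclideanSpace ℝ (Fin d))‖ = 1 := by simp
  have h2 := EuclideanSpace.real_norm_sq_eq (y : EuclideanSpace ℝ (Fin d))
  rw [h] at h2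
  simpa [EuclideanSpace.inner_single_left] using h2.symm

lemma mom_two {d : ℕ} (hd : 1 ≤ d) : mom d 2 hd = 1 / d := by
  have := isProb_uniformSphere d hd
  have hc : ∀ j : Fin d, Continuous (fun y : Sph d => ⟪EuclideanSpace.single j (1:ℝ), (y : EuclideanSpace ℝ (Fin d))⟫ ^ 2) := by
    intro j; fun_prop
  have h1 : ∫ y : Sph d, ∑ j, ⟪EuclideanSpace.single j (1:ℝ), (y : EuclideanSpace ℝ (Fin d))⟫ ^ 2 ∂(uniformSphere d) = 1 := by
    simp only [sum_sq_sph]; simp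
  rw [integral_finsetSum _ (fun j _ => integrable_sph hd _ (hc j))] at h1
  simp only [moment_eq_mom hd 2] at h1
  simp at h1
  have : (d:ℝ) ≠ 0 := by positivity
  field_simp
  linarith

lemma mixed22 {d : ℕ} (hd : 1 ≤ d) (u v : EuclideanSpace ℝ (Fin d)) :
    ∫ y, ⟪u, ((y : Sph d) : EuclideanSpace ℝ (Fin d))⟫ ^ 2 * ⟪v, (y : EuclideanSpace ℝ (Fin d))⟫ ^ 2 ∂(uniformSphere d)
      = mom d 4 hd / 3 * (‖u‖ ^ 2 * ‖v‖ ^ 2 + 2 * ⟪u, v⟫ ^ 2) := by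
  have e : ∀ y : Sph d, ⟪u, (y : EuclideanSpace ℝ (Fin d))⟫ ^ 2 * ⟪v, (y : EuclideanSpace ℝ (Fin d))⟫ ^ 2
      = (⟪u + v, (y : EuclideanSpace ℝ (Fin d))⟫ ^ 4 + ⟪u - v, (y : EuclideanSpace ℝ (Fin d))⟫ ^ 4
        - 2 * ⟪u, (y : EuclideanSpace ℝ (Fin d))⟫ ^ 4 - 2 * ⟪v, (y : EuclideanSpace ℝ (Fin d))⟫ ^ 4) / 12 := by
    intro y
    rw [inner_add_left, inner_sub_left]; ring
  simp only [e]
  have hi : ∀ w : EuclideanSpace ℝ (Fin d), Integrable (fun y : Sph d => ⟪w, (y : EuclideanSpace ℝ (Fin d))⟫ ^ 4) (uniformSphere d) :=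
    fun w => integrable_sph hd _ (by fun_prop)
  have hl := int_comb4 (uniformSphere d) _ _ _ _ (hi (u + v)) (hi (u - v)) (hi u) (hi v) 1 1 (-2) (-2)
  rw [integral_div, show (∫ y : Sph d, (⟪u + v, (y : EuclideanSpace ℝ (Fin d))⟫ ^ 4 + ⟪u - v, (y : EuclideanSpace ℝ (Fin d))⟫ ^ 4
        - 2 * ⟪u, (y : EuclideanSpace ℝ (Fin d))⟫ ^ 4 - 2 * ⟪v, (y : EuclideanSpace ℝ (Fin d))⟫ ^ 4) ∂(uniformSphere d)) = _
    from (integral_congr_ae (ae_of_all _ fun y => by ring)).trans hl]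
  simp only [moment_eq_mom hd 4]
  have h1 : ‖u + v‖ ^ 4 = (‖u‖ ^ 2 + 2 * ⟪u, v⟫ + ‖v‖ ^ 2) ^ 2 := by
    rw [← norm_add_sq_real]; ring
  have h2 : ‖u - v‖ ^ 4 = (‖u‖ ^ 2 - 2 * ⟪u, v⟫ + ‖v‖ ^ 2) ^ 2 := by
    rw [← norm_sub_sq_real]; ring
  rw [h1, h2]
  ring

lemma mom_four {d : ℕ} (hd : 1 ≤ d) : mom d 4 hd = 3 / (d * (d + 2)) := by
  have := isProb_uniformSphere d hd
  set e0 := EuclideanSpace.single (⟨0, hd⟩ : Fin d) (1:ℝ) with he0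
  have h1 : ∫ y : Sph d, ∑ j, ⟪e0, (y : EuclideanSpace ℝ (Fin d))⟫ ^ 2 * ⟪EuclideanSpace.single j (1:ℝ), (y : EuclideanSpace ℝ (Fin d))⟫ ^ 2 ∂(uniformSphere d) = 1 / d := by
    simp only [← Finset.mul_sum, sum_sq_sph, mul_one]
    rw [← mom_two hd]; rfl
  rw [integral_finsetSum _ (fun j _ => integrable_sph hd _ (by fun_prop))] at h1
  simp only [mixed22 hd] at h1
  rw [← Finset.mul_sum, Finset.sum_add_distrib, ← Finset.mul_sum, ← Finset.mul_sum] at h1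
  have h2 : ∑ j : Fin d, ⟪e0, EuclideanSpace.single j (1:ℝ)⟫ ^ 2 = 1 := by
    refine Eq.trans ?_ (sum_sq_sph (⟨e0, by simp [he0]⟩ : Sph d))
    exact Finset.sum_congr rfl fun j _ => by rw [real_inner_comm]
  rw [h2] at h1
  simp [he0] at h1
  have : (d:ℝ) ≠ 0 := by positivity
  field_simp
  field_simp at h1
  linarith

lemma mixed42 {d : ℕ} (hd : 1 ≤ d) (u v : EuclideanSpace ℝ (Fin d)) (hu : ‖u‖ = 1) (hv : ‖v‖ = 1)
    (huv : ⟪u, v⟫ = 0) :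
    ∫ y, ⟪u, ((y : Sph d) : EuclideanSpace ℝ (Fin d))⟫ ^ 4 * ⟪v, (y : EuclideanSpace ℝ (Fin d))⟫ ^ 2 ∂(uniformSphere d)
      = mom d 6 hd / 5 := by
  -- a combination of scalings `s = 1, 2` of `v`
  have e : ∀ y : Sph d, ⟪u, (y : EuclideanSpace ℝ (Fin d))⟫ ^ 4 * ⟪v, (y : EuclideanSpace ℝ (Fin d))⟫ ^ 2
      = (16 * (⟪u + v, (y : EuclideanSpace ℝ (Fin d))⟫ ^ 6 + ⟪u - v, (y : EuclideanSpace ℝ (Fin d))⟫ ^ 6)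
        - (⟪u + (2:ℝ) • v, (y : EuclideanSpace ℝ (Fin d))⟫ ^ 6 + ⟪u - (2:ℝ) • v, (y : EuclideanSpace ℝ (Fin d))⟫ ^ 6)
        - 30 * ⟪u, (y : EuclideanSpace ℝ (Fin d))⟫ ^ 6 + 96 * ⟪v, (y : EuclideanSpace ℝ (Fin d))⟫ ^ 6) / 360 := by
    intro y
    rw [inner_add_left, inner_sub_left, inner_add_left, inner_sub_left, inner_smul_left]
    simp only [conj_trivial]; ring
  simp only [e]
  have hi : ∀ w : EuclideanSpace ℝ (Fin d), Integrable (fun y : Sph d => ⟪w, (y : EuclideanSpace ℝ (Fin d))⟫ ^ 6) (uniformSphere d) :=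
    fun w => integrable_sph hd _ (by fun_prop)
  have hl := int_comb6 (uniformSphere d) _ _ _ _ _ _ (hi (u + v)) (hi (u - v)) (hi (u + (2:ℝ) • v)) (hi (u - (2:ℝ) • v)) (hi u) (hi v) 16 16 (-1) (-1) (-30) 96
  rw [integral_div, show (∫ y : Sph d, (16 * (⟪u + v, (y : EuclideanSpace ℝ (Fin d))⟫ ^ 6 + ⟪u - v, (y : EuclideanSpace ℝ (Fin d))⟫ ^ 6)
        - (⟪u + (2:ℝ) • v, (y : EuclideanSpace ℝ (Fin d))⟫ ^ 6 + ⟪u - (2:ℝ) • v, (y : EuclideanSpace ℝ (Fin d))⟫ ^ 6)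
        - 30 * ⟪u, (y : EuclideanSpace ℝ (Fin d))⟫ ^ 6 + 96 * ⟪v, (y : EuclideanSpace ℝ (Fin d))⟫ ^ 6) ∂(uniformSphere d)) = _
    from (integral_congr_ae (ae_of_all _ fun y => by ring)).trans hl]
  simp only [moment_eq_mom hd 6]
  have h1 : ‖u + v‖ ^ 6 = (‖u‖ ^ 2 + 2 * ⟪u, v⟫ + ‖v‖ ^ 2) ^ 3 := by
    rw [← norm_add_sq_real]; ring
  have h2 : ‖u - v‖ ^ 6 = (‖u‖ ^ 2 - 2 * ⟪u, v⟫ + ‖v‖ ^ 2) ^ 3 := by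
    rw [← norm_sub_sq_real]; ring
  have h3 : ‖u + (2:ℝ) • v‖ ^ 6 = (‖u‖ ^ 2 + 2 * ⟪u, (2:ℝ) • v⟫ + ‖(2:ℝ) • v‖ ^ 2) ^ 3 := by
    rw [← norm_add_sq_real]; ring
  have h4 : ‖u - (2:ℝ) • v‖ ^ 6 = (‖u‖ ^ 2 - 2 * ⟪u, (2:ℝ) • v⟫ + ‖(2:ℝ) • v‖ ^ 2) ^ 3 := by
    rw [← norm_sub_sq_real]; ring
  rw [h1, h2, h3, h4, inner_smul_right, norm_smul, huv, hu, hv]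
  norm_num
  ring

lemma mom_six {d : ℕ} (hd : 1 ≤ d) : mom d 6 hd = 15 / (d * (d + 2) * (d + 4)) := by
  have := isProb_uniformSphere d hd
  set i0 : Fin d := ⟨0, hd⟩ with hi0
  set e0 := EuclideanSpace.single i0 (1:ℝ) with he0
  have h1 : ∫ y : Sph d, ∑ j, ⟪e0, (y : EuclideanSpace ℝ (Fin d))⟫ ^ 4 * ⟪EuclideanSpace.single j (1:ℝ), (y : EuclideanSpace ℝ (Fin d))⟫ ^ 2 ∂(uniformSphere d) = 3 / (d * (d + 2)) := by
    simp only [← Finset.mul_sum, sum_sq_sph, mul_one]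
    rw [← mom_four hd]; rfl
  rw [integral_finsetSum _ (fun j _ => integrable_sph hd _ (by fun_prop))] at h1
  have h2 : ∀ j : Fin d, ∫ y : Sph d, ⟪e0, (y : EuclideanSpace ℝ (Fin d))⟫ ^ 4 * ⟪EuclideanSpace.single j (1:ℝ), (y : EuclideanSpace ℝ (Fin d))⟫ ^ 2 ∂(uniformSphere d)
      = mom d 6 hd / 5 + if j = i0 then 4 / 5 * mom d 6 hd else 0 := by
    intro j
    split_ifs with h
    · subst h
      simp only [← he0, ← pow_add]
      rw [moment_eq_mom hd 6]
      simp [he0]; ring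
    · rw [mixed42 hd _ _ (by simp [he0]) (by simp) (by simp [he0, EuclideanSpace.inner_single_left, Ne.symm h])]; ring
  simp only [h2] at h1
  rw [Finset.sum_add_distrib] at h1
  simp at h1
  have : (d:ℝ) ≠ 0 := by positivity
  field_simp
  field_simp at h1
  linarith

/-- The centered degree two kernel. -/
noncomputable def Kk (d : ℕ) (x y : Sph d) : ℝ :=
  ⟪(x : EuclideanSpace ℝ (Fin d)), (y : EuclideanSpace ℝ (Fin d))⟫ ^ 2 - 1 / d

lemma Kk_symm {d : ℕ} (x y : Sph d) : Kk d x y = Kk d y x := by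
  unfold Kk; rw [real_inner_comm]

@[fun_prop]
lemma continuous_Kk {α : Type*} [TopologicalSpace α] {d : ℕ} {f g : α → Sph d} (hf : Continuous f)
    (hg : Continuous g) : Continuous (fun a => Kk d (f a) (g a)) := by
  unfold Kk; fun_prop

lemma sph_norm {d : ℕ} (x : Sph d) : ‖(x : EuclideanSpace ℝ (Fin d))‖ = 1 := by simp

lemma Kk_self {d : ℕ} (x : Sph d) : Kk d x x = 1 - 1 / d := by
  unfold Kk; rw [real_inner_self_eq_norm_sq, sph_norm]; norm_num

/-- The eigenvalue of the kernel. -/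
noncomputable def lam (d : ℕ) : ℝ := 2 / (d * (d + 2))

lemma lam_nonneg (d : ℕ) : 0 ≤ lam d := by unfold lam; positivity

lemma Kk_conv {d : ℕ} (hd : 1 ≤ d) (x z : Sph d) :
    ∫ y, Kk d x y * Kk d y z ∂(uniformSphere d) = lam d * Kk d x z := by
  have := isProb_uniformSphere d hd
  have hl := int_comb4 (uniformSphere d)
    (fun y : Sph d => ⟪(x : EuclideanSpace ℝ (Fin d)), (y : EuclideanSpace ℝ (Fin d))⟫ ^ 2 * ⟪(z : EuclideanSpace ℝ (Fin d)), (y : EuclideanSpace ℝ (Fin d))⟫ ^ 2)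
    (fun y : Sph d => ⟪(x : EuclideanSpace ℝ (Fin d)), (y : EuclideanSpace ℝ (Fin d))⟫ ^ 2)
    (fun y : Sph d => ⟪(z : EuclideanSpace ℝ (Fin d)), (y : EuclideanSpace ℝ (Fin d))⟫ ^ 2)
    (fun y : Sph d => 1)
    (integrable_sph hd _ (by fun_prop)) (integrable_sph hd _ (by fun_prop))
    (integrable_sph hd _ (by fun_prop)) (integrable_sph hd _ (by fun_prop))
    1 (-1 / d) (-1 / d) (1 / d ^ 2)
  rw [mixed22 hd, moment_eq_mom hd 2, moment_eq_mom hd 2, mom_two, mom_four, sph_norm, sph_norm] at hl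
  refine Eq.trans (integral_congr_ae (ae_of_all _ fun y => ?_)) (hl.trans ?_)
  · simp only [Kk]
    rw [real_inner_comm (z : EuclideanSpace ℝ (Fin d)) (y : EuclideanSpace ℝ (Fin d))]
    ring
  · have : (d:ℝ) ≠ 0 := by positivity
    simp [Kk, lam]
    field_simp
    ring

/-- the law of the sample -/
noncomputable abbrev PP (n d : ℕ) : Measure (Fin n → Sph d) := Measure.pi fun _ : Fin n => uniformSphere d

lemma mp_update {n d : ℕ} (hd : 1 ≤ d) (j : Fin n) :
    MeasurePreserving (fun p : (Fin n → Sph d) × Sph d => Function.update p.1 j p.2)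
      ((PP n d).prod (uniformSphere d)) (PP n d) := by
  have := isProb_uniformSphere d hd
  have hm : Measurable (fun p : (Fin n → Sph d) × Sph d => Function.update p.1 j p.2) := by
    refine Continuous.measurable ?_
    fun_prop
  refine ⟨hm, ?_⟩
  symm
  refine Measure.pi_eq fun s hs => ?_
  rw [Measure.map_apply hm (MeasurableSet.univ_pi hs)]
  have : (fun p : (Fin n → Sph d) × Sph d => Function.update p.1 j p.2) ⁻¹' (Set.univ.pi s)
      = (Set.univ.pi (Function.update s j Set.univ)) ×ˢ s j := by
    ext p
    simp only [Set.mem_preimage, Set.mem_pi, Set.mem_univ, true_implies, Set.mem_prod]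
    constructor
    · intro h
      refine ⟨fun i => ?_, by simpa using h j⟩
      by_cases hi : i = j
      · subst hi; simp
      · simpa [hi] using h i
    · rintro ⟨h1, h2⟩ i
      by_cases hi : i = j
      · subst hi; simpa using h2
      · simpa [hi] using h1 i
  rw [this, Measure.prod_prod, Measure.pi_pi, ← Finset.mul_prod_erase _ _ (Finset.mem_univ j),
    ← Finset.mul_prod_erase Finset.univ (fun i => uniformSphere d (s i)) (Finset.mem_univ j)]
  simp only [Function.update_self, measure_univ, one_mul]
  rw [mul_comm]
  congr 1
  refine Finset.prod_congr rfl fun i hi => ?_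
  rw [Function.update_of_ne (Finset.ne_of_mem_erase hi)]

lemma isProb_PP {n d : ℕ} (hd : 1 ≤ d) : IsProbabilityMeasure (PP n d) := by
  have := isProb_uniformSphere d hd
  unfold PP
  infer_instance

lemma integrable_PP {n d : ℕ} (hd : 1 ≤ d) (F : (Fin n → Sph d) → ℝ) (hF : Continuous F) :
    Integrable F (PP n d) := by
  have := isProb_PP (n := n) hd
  exact hF.integrable_of_hasCompactSupport (HasCompactSupport.of_compactSpace F)

lemma resample {n d : ℕ} (hd : 1 ≤ d) (j : Fin n) (F : (Fin n → Sph d) → ℝ) (hF : Continuous F) :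
    ∫ ω, F ω ∂(PP n d) = ∫ ω, ∫ y, F (Function.update ω j y) ∂(uniformSphere d) ∂(PP n d) := by
  have := isProb_uniformSphere d hd
  have := isProb_PP (n := n) hd
  have hmp := mp_update (n := n) hd j
  have h1 := integral_map (μ := (PP n d).prod (uniformSphere d)) hmp.measurable.aemeasurable (f := F) hF.aestronglyMeasurable
  rw [hmp.map_eq] at h1
  rw [h1, integral_prod]
  have hc : Continuous (fun p : (Fin n → Sph d) × Sph d => F (Function.update p.1 j p.2)) := by fun_prop
  exact hc.integrable_of_hasCompactSupport (HasCompactSupport.of_compactSpace _)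

/-- Integrating out one vertex `j` in a path `i - j - k`. -/
lemma int_out {n d : ℕ} (hd : 1 ≤ d) (i j k : Fin n) (hij : i ≠ j) (hkj : k ≠ j)
    (H : (Fin n → Sph d) → ℝ) (hH : Continuous H) (hHj : ∀ ω y, H (Function.update ω j y) = H ω) :
    ∫ ω, Kk d (ω i) (ω j) * Kk d (ω j) (ω k) * H ω ∂(PP n d)
      = lam d * ∫ ω, Kk d (ω i) (ω k) * H ω ∂(PP n d) := by
  rw [resample hd j _ (by fun_prop), ← integral_const_mul]
  refine integral_congr_ae (ae_of_all _ fun ω => ?_)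
  simp only [hHj, Function.update_self, Function.update_of_ne hij, Function.update_of_ne hkj]
  rw [integral_mul_const, Kk_conv hd]
  ring

/-- pair moments -/
lemma pair_moment {n d : ℕ} (hd : 1 ≤ d) (i j : Fin n) (hij : i ≠ j) (k : ℕ) :
    ∫ ω : Fin n → Sph d, ⟪(ω i : EuclideanSpace ℝ (Fin d)), (ω j : EuclideanSpace ℝ (Fin d))⟫ ^ k ∂(PP n d) = mom d k hd := by
  have := isProb_PP (n := n) hd
  rw [resample hd j _ (by fun_prop)]
  simp only [Function.update_self, Function.update_of_ne hij]
  simp [moment_eq_mom hd k, sph_norm]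

lemma inv_d_mem {d : ℕ} (hd : 1 ≤ d) : 0 ≤ 1 / (d:ℝ) ∧ 1 / (d:ℝ) ≤ 1 := by
  have : (1:ℝ) ≤ d := by exact_mod_cast hd
  exact ⟨by positivity, by rw [div_le_one (by linarith)]; exact this⟩

lemma int_K2 {n d : ℕ} (hd : 1 ≤ d) (i j : Fin n) (hij : i ≠ j) :
    ∫ ω, Kk d (ω i) (ω j) * Kk d (ω j) (ω i) ∂(PP n d) ≤ lam d := by
  have := isProb_PP (n := n) hd
  have h := int_out hd i j i hij hij (fun _ => 1) continuous_const (fun _ _ => rfl)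
  simp only [mul_one, Kk_self] at h
  rw [h]
  simp only [integral_const, probReal_univ, one_smul]
  nlinarith [lam_nonneg d, (inv_d_mem hd).1]

lemma inner_sq_le {d : ℕ} (x y : Sph d) : ⟪(x : EuclideanSpace ℝ (Fin d)), (y : EuclideanSpace ℝ (Fin d))⟫ ^ 2 ≤ 1 := by
  have := abs_real_inner_le_norm (x : EuclideanSpace ℝ (Fin d)) (y : EuclideanSpace ℝ (Fin d))
  rw [sph_norm, sph_norm, mul_one] at this
  rw [← sq_abs]
  exact pow_le_one₀ (abs_nonneg _) this

/-- Fourth order cycle bound. -/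
lemma cycle_bound {n d : ℕ} (hd : 1 ≤ d) (i j k l : Fin n) (hij : i ≠ j) (hjk : j ≠ k) (hkl : k ≠ l)
    (hli : l ≠ i) :
    ∫ ω, Kk d (ω i) (ω j) * Kk d (ω j) (ω k) * (Kk d (ω k) (ω l) * Kk d (ω l) (ω i)) ∂(PP n d)
      ≤ lam d ^ 3 + (if i = k then lam d ^ 2 else 0) + (if j = l then lam d ^ 2 else 0)
        + (if i = k then if j = l then mom d 6 hd + 1 / d ^ 4 else 0 else 0) := by
  have := isProb_PP (n := n) hd
  have hlam := lam_nonneg d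
  have hinv := inv_d_mem hd
  have hm6 : 0 ≤ mom d 6 hd := by rw [mom_six]; positivity
  by_cases hjl : j = l
  · subst hjl
    by_cases hik : i = k
    · subst hik
      simp only [if_true]
      have : ∫ ω, Kk d (ω i) (ω j) * Kk d (ω j) (ω i) * (Kk d (ω i) (ω j) * Kk d (ω j) (ω i)) ∂(PP n d)
          ≤ ∫ ω : Fin n → Sph d, (⟪(ω i : EuclideanSpace ℝ (Fin d)), (ω j : EuclideanSpace ℝ (Fin d))⟫ ^ 6 + 1 / d ^ 4) ∂(PP n d) := by
        refine integral_mono (integrable_PP hd _ (by fun_prop)) (integrable_PP hd _ (by fun_prop)) fun ω => ?_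
        simp only [Kk_symm (ω j) (ω i)]
        have hle := inner_sq_le (ω i) (ω j)
        simp only [Kk]
        set t := ⟪(ω i : EuclideanSpace ℝ (Fin d)), (ω j : EuclideanSpace ℝ (Fin d))⟫
        have ht0 : 0 ≤ t ^ 2 := sq_nonneg t
        have e1 : t ^ 6 = (t ^ 2) ^ 3 := by ring
        have e2 : 1 / (d:ℝ) ^ 4 = (1 / (d:ℝ)) ^ 4 := by simp
        rw [e1, e2]
        generalize t ^ 2 = a at *
        generalize 1 / (d:ℝ) = b at *
        have e3 : (a - b) * (a - b) * ((a - b) * (a - b)) = |a - b| ^ 4 := by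
          rw [Even.pow_abs (by decide)]; ring
        rw [e3]
        rcases le_total a b with h | h
        · have : |a - b| ≤ b := by rw [abs_le]; constructor <;> linarith
          have := pow_le_pow_left₀ (abs_nonneg _) this 4
          have : 0 ≤ a ^ 3 := by positivity
          linarith
        · have : |a - b| ≤ a := by rw [abs_le]; constructor <;> linarith
          have := pow_le_pow_left₀ (abs_nonneg _) this 4
          have : 0 ≤ b ^ 4 := by have := hinv.1; positivity
          have : a ^ 4 ≤ a ^ 3 := pow_le_pow_of_le_one ht0 hle (by norm_num)
          linarith
      rw [integral_add (integrable_PP hd _ (by fun_prop)) (integrable_PP hd _ (by fun_prop)), pair_moment hd i j hij] at this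
      simp only [integral_const, probReal_univ, one_smul] at this
      nlinarith [pow_nonneg hlam 3, pow_nonneg hlam 2]
    · simp only [if_true, if_neg hik]
      -- integrate out `i`
      have h := int_out hd j i j hli hli (fun ω => Kk d (ω j) (ω k) * Kk d (ω k) (ω j)) (by fun_prop)
        (fun ω y => by simp only [Function.update_of_ne hli, Function.update_of_ne (Ne.symm hik)])
      have e : ∫ ω, Kk d (ω i) (ω j) * Kk d (ω j) (ω k) * (Kk d (ω k) (ω j) * Kk d (ω j) (ω i)) ∂(PP n d)
        = ∫ ω, Kk d (ω j) (ω i) * Kk d (ω i) (ω j) * (Kk d (ω j) (ω k) * Kk d (ω k) (ω j)) ∂(PP n d) := by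
        congr 1; ext ω; ring
      rw [e, h]
      simp only [Kk_self]
      rw [integral_const_mul]
      have h2 := int_K2 hd j k hjk
      have h3 : 0 ≤ ∫ ω, Kk d (ω j) (ω k) * Kk d (ω k) (ω j) ∂(PP n d) := by
        refine integral_nonneg fun ω => ?_
        simp only [Kk_symm (ω k) (ω j)]
        exact mul_self_nonneg _
      have h4 : (1 - 1 / (d:ℝ)) * ∫ ω, Kk d (ω j) (ω k) * Kk d (ω k) (ω j) ∂(PP n d) ≤ lam d := by
        nlinarith
      nlinarith [pow_nonneg hlam 3, mul_le_mul_of_nonneg_left h4 hlam]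
  · have h := int_out hd i j k hij (Ne.symm hjk) (fun ω => Kk d (ω k) (ω l) * Kk d (ω l) (ω i)) (by fun_prop)
        (fun ω y => by simp only [Function.update_of_ne hij, Function.update_of_ne (Ne.symm hjk), Function.update_of_ne (Ne.symm hjl)])
    have h' := int_out hd k l i hkl hli.symm (fun ω => Kk d (ω i) (ω k)) (by fun_prop)
        (fun ω y => by simp only [Function.update_of_ne hkl, Function.update_of_ne hli.symm])
    have e : ∫ ω, Kk d (ω i) (ω k) * (Kk d (ω k) (ω l) * Kk d (ω l) (ω i)) ∂(PP n d)
      = ∫ ω, Kk d (ω k) (ω l) * Kk d (ω l) (ω i) * Kk d (ω i) (ω k) ∂(PP n d) := by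
        congr 1; ext ω; ring
    rw [h, e, h']
    by_cases hik : i = k
    · subst hik
      simp only [if_true, if_neg hjl, Kk_self]
      simp only [integral_const, probReal_univ, one_smul]
      have : (1 - 1 / (d:ℝ)) * (1 - 1 / (d:ℝ)) ≤ 1 := by nlinarith
      nlinarith [pow_nonneg hlam 3, mul_le_mul_of_nonneg_left this (pow_nonneg hlam 2)]
    · simp only [if_neg hik, if_neg hjl]
      have h2 := int_K2 hd k i (Ne.symm hik)
      nlinarith [mul_le_mul_of_nonneg_left h2 (pow_nonneg hlam 2)]

open scoped Matrix.Norms.L2Operator in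
lemma opNorm_eq {n : ℕ} (M : Matrix (Fin n) (Fin n) ℝ) : opNorm M = ‖M‖ := by
  rw [Matrix.l2_opNorm_def]; rfl

lemma opNorm_nonneg {n : ℕ} (M : Matrix (Fin n) (Fin n) ℝ) : 0 ≤ opNorm M := norm_nonneg _

open scoped Matrix.Norms.L2Operator in
lemma opNorm_add_le {n : ℕ} (M N : Matrix (Fin n) (Fin n) ℝ) : opNorm (M + N) ≤ opNorm M + opNorm N := by
  simp only [opNorm_eq]; exact norm_add_le _ _

open scoped Matrix.Norms.L2Operator in
lemma opNorm_smul {n : ℕ} (a : ℝ) (M : Matrix (Fin n) (Fin n) ℝ) : opNorm (a • M) = |a| * opNorm M := by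
  simp only [opNorm_eq]; rw [norm_smul]; rfl

lemma opNorm_one_le {n : ℕ} : opNorm (1 : Matrix (Fin n) (Fin n) ℝ) ≤ 1 := by
  unfold opNorm
  refine ContinuousLinearMap.opNorm_le_bound _ zero_le_one fun v => ?_
  simp [Matrix.toLpLin_apply]

lemma opNorm_sq_le {n : ℕ} (M : Matrix (Fin n) (Fin n) ℝ) : opNorm M ^ 2 ≤ ∑ i, ∑ j, M i j ^ 2 := by
  have h0 : 0 ≤ ∑ i, ∑ j, M i j ^ 2 := by positivity
  have : opNorm M ≤ Real.sqrt (∑ i, ∑ j, M i j ^ 2) := by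
    unfold opNorm
    refine ContinuousLinearMap.opNorm_le_bound _ (Real.sqrt_nonneg _) fun v => ?_
    rw [EuclideanSpace.norm_eq v, ← Real.sqrt_mul h0, EuclideanSpace.norm_eq]
    apply Real.sqrt_le_sqrt
    rw [Finset.sum_mul]
    refine Finset.sum_le_sum fun i _ => ?_
    simp only [Real.norm_eq_abs, sq_abs]
    have := Finset.sum_mul_sq_le_sq_mul_sq Finset.univ (fun j => M i j) (fun j => v j)
    simpa [Matrix.toLpLin_apply, Matrix.mulVec, dotProduct] using this
  calc opNorm M ^ 2 ≤ Real.sqrt (∑ i, ∑ j, M i j ^ 2) ^ 2 := by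
        gcongr; exact opNorm_nonneg _
    _ = _ := Real.sq_sqrt h0

open scoped Matrix.Norms.L2Operator in
lemma opNorm_four_le {n : ℕ} (M : Matrix (Fin n) (Fin n) ℝ) (hM : M.transpose = M) :
    opNorm M ^ 4 ≤ ∑ i, ∑ k, (∑ j, M i j * M j k) ^ 2 := by
  have h1 : opNorm (M * M) = opNorm M * opNorm M := by
    simp only [opNorm_eq]
    rw [← Matrix.l2_opNorm_conjTranspose_mul_self, Matrix.conjTranspose_eq_transpose_of_trivial, hM]
  have h2 := opNorm_sq_le (M * M)
  rw [h1] at h2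
  simp only [Matrix.mul_apply] at h2
  calc _ = (opNorm M * opNorm M) ^ 2 := by ring
    _ ≤ _ := h2

/-- off-diagonal kernel matrix -/
noncomputable def Smat {n d : ℕ} (ω : Fin n → Sph d) : Matrix (Fin n) (Fin n) ℝ :=
  Matrix.of fun i j => if i = j then 0 else Kk d (ω i) (ω j)

lemma Smat_symm {n d : ℕ} (ω : Fin n → Sph d) (i j : Fin n) : Smat ω i j = Smat ω j i := by
  simp only [Smat, Matrix.of_apply, Kk_symm (ω i) (ω j), eq_comm]

lemma continuous_Smat {n d : ℕ} (i j : Fin n) : Continuous fun ω : Fin n → Sph d => Smat ω i j := by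
  simp only [Smat, Matrix.of_apply]
  split_ifs
  · exact continuous_const
  · fun_prop

/-- the fourth trace moment -/
noncomputable def Q4 {n d : ℕ} (ω : Fin n → Sph d) : ℝ :=
  ∑ i, ∑ k, (∑ j, Smat ω i j * Smat ω j k) ^ 2

lemma Q4_int {n d : ℕ} (hd : 1 ≤ d) :
    ∫ ω : Fin n → Sph d, Q4 ω ∂(PP n d) ≤ n ^ 4 * lam d ^ 3 + 2 * n ^ 3 * lam d ^ 2 + n ^ 2 * (mom d 6 hd + 1 / d ^ 4) := by
  have hm6 : 0 ≤ mom d 6 hd := by rw [mom_six]; positivity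
  have hlam := lam_nonneg d
  have e : ∀ ω : Fin n → Sph d, Q4 ω = ∑ i, ∑ k, ∑ j, ∑ l, Smat ω i j * Smat ω j k * (Smat ω k l * Smat ω l i) := by
    intro ω
    unfold Q4
    refine Finset.sum_congr rfl fun i _ => Finset.sum_congr rfl fun k _ => ?_
    rw [sq, Finset.sum_mul_sum]
    refine Finset.sum_congr rfl fun j _ => Finset.sum_congr rfl fun l _ => ?_
    rw [Smat_symm ω k l, Smat_symm ω l i]; ring
  have hc := @continuous_Smat n d
  have hcont : ∀ i j k l : Fin n, Continuous fun ω : Fin n → Sph d => Smat ω i j * Smat ω j k * (Smat ω k l * Smat ω l i) :=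
    fun i j k l => ((hc i j).mul (hc j k)).mul ((hc k l).mul (hc l i))
  simp only [e]
  rw [integral_finsetSum _ fun i _ => integrable_PP hd _ (by fun_prop)]
  calc ∑ i : Fin n, ∫ ω : Fin n → Sph d, ∑ k, ∑ j, ∑ l, Smat ω i j * Smat ω j k * (Smat ω k l * Smat ω l i) ∂(PP n d)
      = ∑ i : Fin n, ∑ k : Fin n, ∑ j : Fin n, ∑ l : Fin n, ∫ ω : Fin n → Sph d, Smat ω i j * Smat ω j k * (Smat ω k l * Smat ω l i) ∂(PP n d) := by
        refine Finset.sum_congr rfl fun i _ => ?_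
        rw [integral_finsetSum _ fun i _ => integrable_PP hd _ (by fun_prop)]
        refine Finset.sum_congr rfl fun k _ => ?_
        rw [integral_finsetSum _ fun i _ => integrable_PP hd _ (by fun_prop)]
        refine Finset.sum_congr rfl fun j _ => ?_
        rw [integral_finsetSum _ fun i _ => integrable_PP hd _ (by fun_prop)]
    _ ≤ ∑ i : Fin n, ∑ k : Fin n, ∑ j : Fin n, ∑ l : Fin n, (lam d ^ 3 + (if i = k then lam d ^ 2 else 0) + (if j = l then lam d ^ 2 else 0)
        + (if i = k then if j = l then mom d 6 hd + 1 / d ^ 4 else 0 else 0)) := by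
        refine Finset.sum_le_sum fun i _ => Finset.sum_le_sum fun k _ => Finset.sum_le_sum fun j _ => Finset.sum_le_sum fun l _ => ?_
        by_cases hij : i = j
        · simp [Smat, hij]; positivity
        by_cases hjk : j = k
        · simp [Smat, hjk]; positivity
        by_cases hkl : k = l
        · simp [Smat, hkl]; positivity
        by_cases hli : l = i
        · simp [Smat, hli]; positivity
        have := cycle_bound hd i j k l hij hjk hkl hli
        simpa only [Smat, Matrix.of_apply, if_neg hij, if_neg hjk, if_neg hkl, if_neg hli] using this
    _ = _ := by
        simp only [Finset.sum_add_distrib, Finset.sum_const, Finset.card_univ, Fintype.card_fin, Finset.sum_ite_eq,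
          Finset.mem_univ, if_true, nsmul_eq_mul]
        have : ∀ i k : Fin n, (∑ j : Fin n, ∑ l : Fin n, (if i = k then if j = l then mom d 6 hd + 1 / (d:ℝ) ^ 4 else 0 else 0))
          = if i = k then n * (mom d 6 hd + 1 / (d:ℝ) ^ 4) else 0 := by
          intro i k
          split_ifs
          · simp; ring
          · simp
        simp only [this, ← Finset.mul_sum, Finset.sum_ite_eq, Finset.mem_univ, if_true, Finset.sum_const, Finset.card_univ, Fintype.card_fin, nsmul_eq_mul]
        ring

/-- remainder control -/
noncomputable def QR (a b : ℝ) {n d : ℕ} (ω : Fin n → Sph d) : ℝ :=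
  ∑ i : Fin n, ∑ j : Fin n, if i = j then 0 else
    (a * ⟪(ω i : EuclideanSpace ℝ (Fin d)), (ω j : EuclideanSpace ℝ (Fin d))⟫ ^ 4
      + b * ⟪(ω i : EuclideanSpace ℝ (Fin d)), (ω j : EuclideanSpace ℝ (Fin d))⟫ ^ 6)

lemma continuous_QR (a b : ℝ) {n d : ℕ} : Continuous (QR a b : (Fin n → Sph d) → ℝ) := by
  unfold QR
  refine continuous_finsetSum _ fun i _ => continuous_finsetSum _ fun j _ => ?_
  split_ifs
  · exact continuous_const
  · fun_prop

lemma continuous_Q4 {n d : ℕ} : Continuous (Q4 : (Fin n → Sph d) → ℝ) := by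
  unfold Q4
  have hc := @continuous_Smat n d
  fun_prop

lemma QR_int (a b : ℝ) (ha : 0 ≤ a) (hb : 0 ≤ b) {n d : ℕ} (hd : 1 ≤ d) :
    ∫ ω : Fin n → Sph d, QR a b ω ∂(PP n d) ≤ n ^ 2 * (a * mom d 4 hd + b * mom d 6 hd) := by
  have hm4 : 0 ≤ mom d 4 hd := by rw [mom_four]; positivity
  have hm6 : 0 ≤ mom d 6 hd := by rw [mom_six]; positivity
  have hc : ∀ i j : Fin n, Continuous fun ω : Fin n → Sph d => if i = j then (0:ℝ) else
    (a * ⟪(ω i : EuclideanSpace ℝ (Fin d)), (ω j : EuclideanSpace ℝ (Fin d))⟫ ^ 4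
      + b * ⟪(ω i : EuclideanSpace ℝ (Fin d)), (ω j : EuclideanSpace ℝ (Fin d))⟫ ^ 6) := by
    intro i j
    split_ifs
    · exact continuous_const
    · fun_prop
  unfold QR
  rw [integral_finsetSum _ fun i _ => integrable_PP hd _ (by fun_prop)]
  calc _ ≤ ∑ i : Fin n, ∑ j : Fin n, (a * mom d 4 hd + b * mom d 6 hd) := by
        refine Finset.sum_le_sum fun i _ => ?_
        rw [integral_finsetSum _ fun i _ => integrable_PP hd _ (by fun_prop)]
        refine Finset.sum_le_sum fun j _ => ?_
        split_ifs with h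
        · simp; positivity
        · rw [integral_add (integrable_PP hd _ (by fun_prop)) (integrable_PP hd _ (by fun_prop)), integral_const_mul, integral_const_mul,
            pair_moment hd i j h, pair_moment hd i j h]
    _ = _ := by simp; ring

lemma markov {n d : ℕ} (hd : 1 ≤ d) (F : (Fin n → Sph d) → ℝ) (hF : Continuous F) (hF0 : ∀ ω, 0 ≤ F ω)
    (η : ℝ) (hη : 0 < η) (B : ℝ) (hB : ∫ ω, F ω ∂(PP n d) ≤ B) :
    PP n d {ω | η ≤ F ω} ≤ ENNReal.ofReal (B / η) := by
  have := isProb_PP (n := n) hd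
  have h := mul_meas_ge_le_integral_of_nonneg (ae_of_all _ hF0) (integrable_PP hd F hF) η
  rw [← ofReal_measureReal]
  apply ENNReal.ofReal_le_ofReal
  rw [le_div_iff₀ hη]
  linarith

lemma main_bound {n d : ℕ} (hd : 1 ≤ d) (g : ℝ → ℝ) (b1 b2 ε e1 C1 : ℝ) (hε : 0 < ε) 
    (hR : ∀ t, t ^ 2 ≤ 1 → |g t - g 0 - b1 * t - b2 / 2 * t ^ 2| ≤ e1 * t ^ 2 + C1 * |t| ^ 3)
    (hb2 : |b2| / (2 * d) ≤ ε / 3) :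
    PP n d {ω | ε < opNorm
                ((Matrix.of fun i j : Fin n =>
                    g ⟪(ω i : EuclideanSpace ℝ (Fin d)),
                       (ω j : EuclideanSpace ℝ (Fin d))⟫) -
                 (Matrix.of fun i j : Fin n =>
                    (g 0 + b2 / (2 * (d : ℝ)))
                      + b1 * ⟪(ω i : EuclideanSpace ℝ (Fin d)),
                                     (ω j : EuclideanSpace ℝ (Fin d))⟫
                      + (g 1 - g 0 - b1) * (if i = j then 1 else 0)))}
      ≤ ENNReal.ofReal ((n ^ 4 * lam d ^ 3 + 2 * n ^ 3 * lam d ^ 2 + n ^ 2 * (mom d 6 hd + 1 / d ^ 4)) / (2 * ε / (3 * (|b2| + 1))) ^ 4)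
        + ENNReal.ofReal ((n ^ 2 * (2 * e1 ^ 2 * mom d 4 hd + 2 * C1 ^ 2 * mom d 6 hd)) / (ε / 3) ^ 2) := by
  set η := 2 * ε / (3 * (|b2| + 1)) with hη
  have hηpos : 0 < η := by positivity
  refine le_trans (measure_mono (t := {ω | η ^ 4 ≤ Q4 ω} ∪ {ω | (ε / 3) ^ 2 ≤ QR (2 * e1 ^ 2) (2 * C1 ^ 2) ω}) ?_)
    ((measure_union_le _ _).trans (add_le_add ?_ ?_))
  · intro ω hω
    simp only [Set.mem_union, Set.mem_ofPred_eq] at hω ⊢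
    by_contra! hcon
    obtain ⟨hc1, hc2⟩ := hcon
    refine absurd hω (not_lt.2 ?_)
    set Rm : Matrix (Fin n) (Fin n) ℝ := Matrix.of fun i j => if i = j then 0 else
      (g ⟪(ω i : EuclideanSpace ℝ (Fin d)), (ω j : EuclideanSpace ℝ (Fin d))⟫ - g 0
        - b1 * ⟪(ω i : EuclideanSpace ℝ (Fin d)), (ω j : EuclideanSpace ℝ (Fin d))⟫
        - b2 / 2 * ⟪(ω i : EuclideanSpace ℝ (Fin d)), (ω j : EuclideanSpace ℝ (Fin d))⟫ ^ 2) with hRm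
    have hdec : ((Matrix.of fun i j : Fin n =>
                    g ⟪(ω i : EuclideanSpace ℝ (Fin d)),
                       (ω j : EuclideanSpace ℝ (Fin d))⟫) -
                 (Matrix.of fun i j : Fin n =>
                    (g 0 + b2 / (2 * (d : ℝ)))
                      + b1 * ⟪(ω i : EuclideanSpace ℝ (Fin d)),
                                     (ω j : EuclideanSpace ℝ (Fin d))⟫
                      + (g 1 - g 0 - b1) * (if i = j then 1 else 0)))
        = (-(b2 / (2 * d))) • (1 : Matrix (Fin n) (Fin n) ℝ) + (b2 / 2) • Smat ω + Rm := by
      ext i j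
      simp only [Matrix.sub_apply, Matrix.of_apply, Matrix.add_apply, Matrix.smul_apply, smul_eq_mul, Matrix.one_apply, Smat, hRm]
      by_cases h : i = j
      · subst h
        simp only [if_true]
        rw [real_inner_self_eq_norm_sq, sph_norm]
        norm_num
        ring
      · simp only [if_neg h, Kk]
        ring
    rw [hdec]
    have hS : opNorm (Smat ω) < η := by
      have h4 := opNorm_four_le (Smat ω) (by ext i j; rw [Matrix.transpose_apply, Smat_symm])
      exact lt_of_pow_lt_pow_left₀ 4 hηpos.le (h4.trans_lt hc1)
    have hRn : opNorm Rm < ε / 3 := by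
      have h4 := opNorm_sq_le Rm
      refine lt_of_pow_lt_pow_left₀ 2 (by positivity) ((h4.trans ?_).trans_lt hc2)
      unfold QR
      refine Finset.sum_le_sum fun i _ => Finset.sum_le_sum fun j _ => ?_
      simp only [hRm, Matrix.of_apply]
      split_ifs with h
      · simp
      · have := hR _ (inner_sq_le (ω i) (ω j))
        set t := ⟪(ω i : EuclideanSpace ℝ (Fin d)), (ω j : EuclideanSpace ℝ (Fin d))⟫
        rw [← sq_abs]
        calc _ ≤ (e1 * t ^ 2 + C1 * |t| ^ 3) ^ 2 := by gcongr
          _ ≤ 2 * (e1 * t ^ 2) ^ 2 + 2 * (C1 * |t| ^ 3) ^ 2 := by nlinarith [sq_nonneg (e1 * t ^ 2 - C1 * |t| ^ 3)]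
          _ = 2 * e1 ^ 2 * t ^ 4 + 2 * C1 ^ 2 * |t| ^ 6 := by ring
          _ = _ := by rw [Even.pow_abs (by decide)]
    have h1 := opNorm_add_le ((-(b2 / (2 * d))) • (1 : Matrix (Fin n) (Fin n) ℝ) + (b2 / 2) • Smat ω) Rm
    have h2 := opNorm_add_le ((-(b2 / (2 * d))) • (1 : Matrix (Fin n) (Fin n) ℝ)) ((b2 / 2) • Smat ω)
    rw [opNorm_smul, opNorm_smul] at h2
    have h3 : |(-(b2 / (2 * (d:ℝ))))| * opNorm (1 : Matrix (Fin n) (Fin n) ℝ) ≤ ε / 3 := by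
      refine le_trans (mul_le_of_le_one_right (abs_nonneg _) opNorm_one_le) ?_
      rw [abs_neg, abs_div, abs_of_nonneg (by positivity : (0:ℝ) ≤ 2 * d)]
      exact hb2
    have h4 : |b2 / 2| * opNorm (Smat ω) ≤ ε / 3 := by
      rw [abs_div, abs_two]
      calc |b2| / 2 * opNorm (Smat ω) ≤ (|b2| + 1) / 2 * η := by
            gcongr
            · exact opNorm_nonneg _
            · linarith
        _ = ε / 3 := by rw [hη]; field_simp
    linarith
  · exact markov hd _ continuous_Q4 (fun ω => by unfold Q4; positivity) _ (by positivity) _ (Q4_int hd)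
  · refine markov hd _ (continuous_QR _ _) (fun ω => ?_) _ (by positivity) _ (QR_int _ _ (by positivity) (by positivity) hd)
    unfold QR
    refine Finset.sum_nonneg fun i _ => Finset.sum_nonneg fun j _ => ?_
    split_ifs
    · exact le_rfl
    · have : ∀ t : ℝ, 0 ≤ 2 * e1 ^ 2 * t ^ 4 + 2 * C1 ^ 2 * t ^ 6 := fun t => by
        have : 0 ≤ t ^ 4 := Even.pow_nonneg (by decide) t
        have : 0 ≤ t ^ 6 := Even.pow_nonneg (by decide) t
        positivity
      exact this _

lemma final_arith (n d C : ℝ) (hd : 1 ≤ d) (hn : 0 ≤ n) (hnC : n ≤ C * d) (l m4 m6 a b : ℝ)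
    (ha : 0 ≤ a) (hb : 0 ≤ b) (hl0 : 0 ≤ l) (hl : l = 2 / (d * (d + 2)))
    (h4 : m4 = 3 / (d * (d + 2))) (h6 : m6 = 15 / (d * (d + 2) * (d + 4))) :
    n ^ 4 * l ^ 3 + 2 * n ^ 3 * l ^ 2 + n ^ 2 * (m6 + 1 / d ^ 4) ≤ (8 * C ^ 4 + 8 * C ^ 3 + 16 * C ^ 2) / d ∧
    n ^ 2 * (2 * a * m4 + 2 * b * m6) ≤ 6 * C ^ 2 * a + 30 * C ^ 2 * b / d := by
  have hd0 : 0 < d := by linarith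
  have hC : 0 ≤ C := by
    by_contra! h
    nlinarith
  have hl' : l ≤ 2 / d ^ 2 := by
    rw [hl]; gcongr; nlinarith
  have h4' : m4 ≤ 3 / d ^ 2 := by
    rw [h4]; gcongr; nlinarith
  have h6' : m6 ≤ 15 / d ^ 3 := by
    rw [h6]; gcongr; nlinarith [sq_nonneg d]
  have h40 : 0 ≤ m4 := by rw [h4]; positivity
  have h60 : 0 ≤ m6 := by rw [h6]; positivity
  have hinv : 1 / d ≤ 1 := by rw [div_le_one hd0]; exact hd
  have hinv0 : 0 ≤ 1 / d := by positivity
  have h1d4 : 1 / d ^ 4 ≤ 1 / d ^ 3 := by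
    apply one_div_le_one_div_of_le (by positivity)
    exact pow_le_pow_right₀ hd (by norm_num)
  constructor
  · calc n ^ 4 * l ^ 3 + 2 * n ^ 3 * l ^ 2 + n ^ 2 * (m6 + 1 / d ^ 4)
        ≤ (C * d) ^ 4 * (2 / d ^ 2) ^ 3 + 2 * (C * d) ^ 3 * (2 / d ^ 2) ^ 2 + (C * d) ^ 2 * (15 / d ^ 3 + 1 / d ^ 3) := by
          gcongr
      _ = 8 * C ^ 4 * (1 / d) * (1 / d) + 8 * C ^ 3 * (1 / d) + 16 * C ^ 2 * (1 / d) := by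
          field_simp; ring
      _ ≤ 8 * C ^ 4 * (1 / d) * 1 + 8 * C ^ 3 * (1 / d) + 16 * C ^ 2 * (1 / d) := by
          gcongr
      _ = _ := by field_simp
  · calc n ^ 2 * (2 * a * m4 + 2 * b * m6) ≤ (C * d) ^ 2 * (2 * a * (3 / d ^ 2) + 2 * b * (15 / d ^ 3)) := by gcongr
      _ = _ := by field_simp; ring

theorem stmt_13 (σa : ℝ) (hσ0 : 0 < σa ^ 2) (hσ1 : σa ^ 2 < 1)
    (c : ℝ) (hc : 0 < c) (d : ℕ → ℕ)
    (hd : Tendsto (fun n : ℕ => (d n : ℝ) / n) atTop (nhds c))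
    (g : ℝ → ℝ)
    (hg : ∀ t ∈ Set.Icc (-1 : ℝ) 1,
      g t ∈ Set.Icc (-1 : ℝ) 1 ∧ g t = σa ^ 2 * fDual (g t) + (1 - σa ^ 2) * t) :
    ∀ ε > (0 : ℝ),
      Tendsto
        (fun n : ℕ =>
          (Measure.pi fun _ : Fin n => uniformSphere (d n))
            {ω : Fin n → Metric.sphere (0 : EuclideanSpace ℝ (Fin (d n))) 1 |
              ε < opNorm
                ((Matrix.of fun i j : Fin n =>
                    g ⟪(ω i : EuclideanSpace ℝ (Fin (d n))),
                       (ω j : EuclideanSpace ℝ (Fin (d n)))⟫) -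
                 (Matrix.of fun i j : Fin n =>
                    (g 0 + deriv (deriv g) 0 / (2 * (d n : ℝ)))
                      + deriv g 0 * ⟪(ω i : EuclideanSpace ℝ (Fin (d n))),
                                     (ω j : EuclideanSpace ℝ (Fin (d n)))⟫
                      + (g 1 - g 0 - deriv g 0) * (if i = j then 1 else 0)))})
        atTop (nhds 0) := by
  intro ε hε
  have hcd := g_contDiffAt (σa ^ 2) hσ0 hσ1 g hg
  set b1 := deriv g 0 with hb1
  set b2 := deriv (deriv g) 0 with hb2
  rw [ENNReal.tendsto_nhds_zero]
  intro κ hκ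
  obtain ⟨r, hr0, hrκ⟩ : ∃ r : ℝ, 0 < r ∧ ENNReal.ofReal r ≤ κ := by
    obtain ⟨q, hq0, hq⟩ := ENNReal.lt_iff_exists_real_btwn.1 hκ
    refine ⟨q, ?_, hq.2.le⟩
    simpa using hq.1
  set C : ℝ := 2 / c with hC
  have hCpos : 0 < C := by positivity
  set ηR : ℝ := (ε / 3) ^ 2 with hηR
  have hηRpos : 0 < ηR := by positivity
  set η4 : ℝ := (2 * ε / (3 * (|b2| + 1))) ^ 4 with hη4
  have hη4pos : 0 < η4 := by positivity
  set e1 : ℝ := Real.sqrt (r * ηR / (24 * C ^ 2)) with he1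
  have he1pos : 0 < e1 := Real.sqrt_pos.2 (by positivity)
  have he1sq : e1 ^ 2 = r * ηR / (24 * C ^ 2) := Real.sq_sqrt (by positivity)
  obtain ⟨δ, hδ, hpe⟩ := peano2 g hcd e1 he1pos
  rw [← hb1, ← hb2] at hpe
  set C1 : ℝ := (2 + |b1| + |b2| / 2) / δ ^ 3 with hC1
  have hC1pos : 0 < C1 := by positivity
  have hR : ∀ t : ℝ, t ^ 2 ≤ 1 → |g t - g 0 - b1 * t - b2 / 2 * t ^ 2| ≤ e1 * t ^ 2 + C1 * |t| ^ 3 := by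
    intro t ht
    by_cases h : |t| < δ
    · have := hpe t h
      have : 0 ≤ C1 * |t| ^ 3 := by positivity
      linarith
    · push Not at h
      have ht1 : |t| ≤ 1 := (sq_le_one_iff_abs_le_one t).1 ht
      have hgt := abs_le.2 (hg t (abs_le.1 ht1)).1
      have hg0 := abs_le.2 (hg 0 (by constructor <;> norm_num)).1
      have e1' : |b1 * t| ≤ |b1| := by
        rw [abs_mul]; exact mul_le_of_le_one_right (abs_nonneg _) ht1
      have e2' : |b2 / 2 * t ^ 2| ≤ |b2| / 2 := by
        rw [abs_mul, abs_div, abs_two, abs_of_nonneg (sq_nonneg t)]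
        exact mul_le_of_le_one_right (by positivity) ht
      have hB : |g t - g 0 - b1 * t - b2 / 2 * t ^ 2| ≤ 2 + |b1| + |b2| / 2 := by
        have i1 := abs_sub (g t - g 0 - b1 * t) (b2 / 2 * t ^ 2)
        have i2 := abs_sub (g t - g 0) (b1 * t)
        have i3 := abs_sub (g t) (g 0)
        linarith
      have hpow : δ ^ 3 ≤ |t| ^ 3 := by gcongr
      have : 2 + |b1| + |b2| / 2 ≤ C1 * |t| ^ 3 := by
        calc 2 + |b1| + |b2| / 2 = C1 * δ ^ 3 := by rw [hC1]; field_simp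
          _ ≤ C1 * |t| ^ 3 := by gcongr
      have : 0 ≤ e1 * t ^ 2 := by positivity
      linarith
  -- growth of the dimension
  have hev1 : ∀ᶠ n : ℕ in atTop, c / 2 < (d n : ℝ) / n := hd.eventually (lt_mem_nhds (by linarith))
  have hdtop : Tendsto (fun n : ℕ => (d n : ℝ)) atTop atTop := by
    have h1 : Tendsto (fun n : ℕ => (n : ℝ) * (c / 2)) atTop atTop :=
      tendsto_natCast_atTop_atTop.atTop_mul_const (by positivity)
    refine tendsto_atTop_mono' _ ?_ h1
    filter_upwards [hev1, eventually_gt_atTop 0] with n hn hn0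
    have : (0:ℝ) < n := by exact_mod_cast hn0
    rw [lt_div_iff₀ this] at hn
    linarith
  set B : ℝ := 8 * C ^ 4 + 8 * C ^ 3 + 16 * C ^ 2 with hB
  have hev2 : ∀ᶠ n : ℕ in atTop, (B / η4 + 30 * C ^ 2 * C1 ^ 2 / ηR) / (d n : ℝ) < r / 2 := by
    have : Tendsto (fun n : ℕ => (B / η4 + 30 * C ^ 2 * C1 ^ 2 / ηR) / (d n : ℝ)) atTop (nhds 0) :=
      hdtop.const_div_atTop _
    exact this.eventually (gt_mem_nhds (by positivity))
  have hev3 : ∀ᶠ n : ℕ in atTop, (|b2| / 2) / (d n : ℝ) < ε / 3 := by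
    have : Tendsto (fun n : ℕ => (|b2| / 2) / (d n : ℝ)) atTop (nhds 0) :=
      hdtop.const_div_atTop _
    exact this.eventually (gt_mem_nhds (by positivity))
  filter_upwards [hev1, hev2, hev3, eventually_gt_atTop 0, hdtop.eventually_ge_atTop 1] with n h1 h2 h3 hn0 hd1
  have hdn : 1 ≤ d n := by exact_mod_cast hd1
  have hnpos : (0:ℝ) < n := by exact_mod_cast hn0
  have hnC : (n:ℝ) ≤ C * d n := by
    rw [lt_div_iff₀ hnpos] at h1
    rw [hC, div_mul_eq_mul_div, le_div_iff₀ hc]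
    linarith
  refine (main_bound (n := n) hdn g b1 b2 ε e1 C1 hε hR ?_).trans (le_trans ?_ hrκ)
  · rw [div_div] at h3; exact h3.le
  · have hm6 : 0 ≤ mom (d n) 6 hdn := by rw [mom_six]; positivity
    have hm4 : 0 ≤ mom (d n) 4 hdn := by rw [mom_four]; positivity
    have hlam := lam_nonneg (d n)
    rw [← hηR, ← hη4, ← ENNReal.ofReal_add (by positivity) (by positivity)]
    apply ENNReal.ofReal_le_ofReal
    have hb := final_arith n (d n : ℝ) C hd1 hnpos.le hnC (lam (d n)) (mom (d n) 4 hdn) (mom (d n) 6 hdn) (e1 ^ 2) (C1 ^ 2)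
      (by positivity) (by positivity) hlam rfl (mom_four hdn) (mom_six hdn)
    have k1 : (n ^ 4 * lam (d n) ^ 3 + 2 * n ^ 3 * lam (d n) ^ 2 + n ^ 2 * (mom (d n) 6 hdn + 1 / (d n : ℝ) ^ 4)) / η4 ≤ B / d n / η4 := by
      gcongr
      exact hb.1
    have k2 : (n ^ 2 * (2 * e1 ^ 2 * mom (d n) 4 hdn + 2 * C1 ^ 2 * mom (d n) 6 hdn)) / ηR ≤ (6 * C ^ 2 * e1 ^ 2 + 30 * C ^ 2 * C1 ^ 2 / d n) / ηR := by
      gcongr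
      exact hb.2
    have k3 : 6 * C ^ 2 * e1 ^ 2 / ηR = r / 4 := by
      rw [he1sq]; field_simp; norm_num
    have k4 : (B / η4 + 30 * C ^ 2 * C1 ^ 2 / ηR) / (d n : ℝ) = B / d n / η4 + 30 * C ^ 2 * C1 ^ 2 / d n / ηR := by
      field_simp
    rw [add_div] at k2
    linarith
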